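/- For each integer k ≥ 1 there exists a unique family (α₂ⱼ^{2k+1})_{j=1,…,k} of elements of ℋ such that each α₂ⱼ^{2k+1} is homogeneous of weight 2j and, setting A_{2k+1} = ∂^{2k+1} + Σ_{j=1}^{k} (α₂ⱼ^{2k+1} ∘ ∂^{2k−2j+1} + ∂^{2k−2j+1} ∘ α₂ⱼ^{2k+1}) (a ℂ-linear endomorphism of ℋ, elements of ℋ acting by multiplication), the commutator [L, A_{2k+1}] is the operator of multiplication by some element of ℋ; moreover this element r_{2k+3} := [L, A_{2k+1}] is homogeneous of weight 2k+3. -/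

import Mathlib

/-!
STATEMENT 0. ℋ = ℂ[u₀,u₁,…] with derivation ∂(uᵢ) = uᵢ₊₁, wt(uᵢ) = i+2,
L = ∂² − u₀.  For each k ≥ 1 there is a unique family α₂ⱼ^{2k+1} (j=1,…,k) of
homogeneous elements of weight 2j such that the commutator [L, A_{2k+1}] is a
multiplication operator; moreover r_{2k+3} := [L, A_{2k+1}] is homogeneous of
weight 2k+3.
-/

open MvPolynomial

noncomputable section

/-- The algebra ℋ = ℂ[u₀, u₁, u₂, …]. -/
abbrev HH : Type := MvPolynomial ℕ ℂ

/-- The derivation ∂ with ∂(uᵢ) = uᵢ₊₁. -/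
noncomputable def Hder : Derivation ℂ HH HH :=
  MvPolynomial.mkDerivation ℂ (fun i => MvPolynomial.X (i + 1))

/-- ∂ as a ℂ-linear endomorphism of ℋ. -/
noncomputable def Dop : Module.End ℂ HH := Hder.toLinearMap

/-- The multiplication operator by c ∈ ℋ. -/
noncomputable def mulH (c : HH) : Module.End ℂ HH := LinearMap.mulLeft ℂ c

/-- L = ∂² − u₀. -/
noncomputable def LopH : Module.End ℂ HH := Dop ^ 2 - mulH (MvPolynomial.X 0)

/-- The grading: wt(uᵢ) = i + 2. -/
def wtH : ℕ → ℕ := fun i => i + 2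

/-- A_{2k+1} = ∂^{2k+1} + Σ_{j=1}^{k} (α_{2j} ∘ ∂^{2k−2j+1} + ∂^{2k−2j+1} ∘ α_{2j}). -/
noncomputable def AopH (k : ℕ) (α : Fin k → HH) : Module.End ℂ HH :=
  Dop ^ (2 * k + 1) +
    ∑ j : Fin k, (mulH (α j) * Dop ^ (2 * k - 2 * ((j : ℕ) + 1) + 1)
      + Dop ^ (2 * k - 2 * ((j : ℕ) + 1) + 1) * mulH (α j))

@[simp] lemma Dop_apply (f : HH) : Dop f = Hder f := rfl

@[simp] lemma mulH_apply (c f : HH) : mulH c f = c * f := rfl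

@[simp] lemma Hder_X (i : ℕ) : Hder (X i) = X (i + 1) := mkDerivation_X _ _ _

lemma Dop_mul_mulH (c : HH) : Dop * mulH c = mulH (Hder c) + mulH c * Dop := by
  refine LinearMap.ext fun f => ?_
  simp [add_comm, mul_comm]

lemma mulH_add (a b : HH) : mulH (a + b) = mulH a + mulH b := by
  refine LinearMap.ext fun f => ?_
  simp [add_mul]

lemma mulH_smul (r : ℂ) (a : HH) : mulH (r • a) = r • mulH a := by
  refine LinearMap.ext fun f => ?_
  simp

lemma mulH_mul (a b : HH) : mulH (a * b) = mulH a * mulH b := by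
  refine LinearMap.ext fun f => ?_
  simp [mul_assoc]

@[simp] lemma mulH_zero : mulH 0 = 0 := by
  refine LinearMap.ext fun f => ?_
  simp

lemma lopH_eq : LopH = Dop ^ 2 + mulH (-X 0) := by
  refine LinearMap.ext fun f => ?_
  simp [LopH, sub_eq_add_neg]

/-! ### The kernel of `∂` -/

lemma pderiv_succ_Hder (j : ℕ) (f : HH) :
    pderiv (j + 1) (Hder f) = Hder (pderiv (j + 1) f) + pderiv j f := by
  have h : ⁅(pderiv (j + 1) : Derivation ℂ HH HH), Hder⁆ = pderiv j := by
    refine derivation_ext fun i => ?_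
    simp only [Derivation.commutator_apply, Hder_X, pderiv_X, Pi.single_apply]
    split_ifs <;> first | omega | simp
  have := DFunLike.congr_fun h f
  rw [Derivation.commutator_apply, sub_eq_iff_eq_add] at this
  rw [this, add_comm]

lemma exists_pderiv_eq_zero (f : HH) : ∃ M, ∀ N ≥ M, pderiv N f = 0 := by
  refine ⟨f.vars.sup id + 1, fun N hN => pderiv_eq_zero_of_notMem_vars fun h => ?_⟩
  have : N ≤ f.vars.sup id := Finset.le_sup (f := id) h
  omega

lemma pderiv_eq_zero_of_Hder_eq_zero {f : HH} (hf : Hder f = 0) (j : ℕ) : pderiv j f = 0 := by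
  obtain ⟨M, hM⟩ := exists_pderiv_eq_zero f
  by_cases hj : M ≤ j
  · exact hM j hj
  · refine Nat.decreasingInduction (motive := fun n _ => pderiv n f = 0) (fun n _ ih => ?_)
      (hM M le_rfl) (not_le.mp hj).le
    have := pderiv_succ_Hder n f
    simpa [hf, ih] using this.symm

lemma eq_zero_of_Hder_eq_zero {f : HH} {n : ℕ} (hn : n ≠ 0)
    (hw : f.IsWeightedHomogeneous wtH n) (hf : Hder f = 0) : f = 0 := by
  ext d
  rw [coeff_zero]
  by_contra hd
  have hd0 : d ≠ 0 := by
    rintro rfl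
    exact hn (by simpa using (hw hd).symm)
  obtain ⟨i, hi⟩ := Finsupp.ne_iff.mp hd0
  rw [Finsupp.zero_apply] at hi
  have h := coeff_pderiv (i := i) f (d - Finsupp.single i 1)
  have hsub : d - Finsupp.single i 1 + Finsupp.single i 1 = d :=
    tsub_add_cancel_of_le (by simpa using Nat.one_le_iff_ne_zero.mpr hi)
  rw [pderiv_eq_zero_of_Hder_eq_zero hf, coeff_zero, hsub] at h
  rcases mul_eq_zero.mp h.symm with h | h
  · exact hd h
  · exact Nat.cast_add_one_ne_zero _ h

/-! ### Homogeneous operators -/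

lemma IsWeightedHomogeneous.Hder {f : HH} {n : ℕ} (hf : f.IsWeightedHomogeneous wtH n) :
    (Hder f).IsWeightedHomogeneous wtH (n + 1) := by
  induction hf using IsWeightedHomogeneous.induction_on with
  | zero => simpa using isWeightedHomogeneous_zero ℂ wtH (n + 1)
  | add p q _ _ hp hq => simpa using hp.add hq
  | monomial d r hd =>
    rw [_root_.Hder, mkDerivation_monomial]
    refine (weightedHomogeneousSubmodule ℂ wtH (n + 1)).smul_mem r
      (IsWeightedHomogeneous.sum _ _ _ fun i hi => ?_)
    have hi := Finsupp.weight_sub_single_add (w := wtH) (Finsupp.mem_support_iff.mp hi)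
    have hn : n + 1 = Finsupp.weight wtH (d - Finsupp.single i 1) + wtH (i + 1) := by
      rw [← hd, ← hi]
      simp only [wtH]
      omega
    rw [hn]
    exact (isWeightedHomogeneous_monomial wtH _ _ rfl).mul (isWeightedHomogeneous_X ℂ wtH (i + 1))

/-- `T` maps elements of weight `n` to elements of weight `n + d`. -/
def IsHomogeneousOp (d : ℕ) (T : Module.End ℂ HH) : Prop :=
  ∀ n f, f.IsWeightedHomogeneous wtH n → (T f).IsWeightedHomogeneous wtH (n + d)

namespace IsHomogeneousOp

lemma dop : IsHomogeneousOp 1 Dop := fun _ _ hf => IsWeightedHomogeneous.Hder hf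

lemma mulH {c : HH} {d : ℕ} (hc : c.IsWeightedHomogeneous wtH d) : IsHomogeneousOp d (mulH c) :=
  fun n f hf => by
    rw [mulH_apply, add_comm]
    exact IsWeightedHomogeneous.mul hc hf

variable {d e : ℕ} {S T : Module.End ℂ HH}

lemma add (hS : IsHomogeneousOp d S) (hT : IsHomogeneousOp d T) : IsHomogeneousOp d (S + T) :=
  fun n f hf => (hS n f hf).add (hT n f hf)

lemma sub (hS : IsHomogeneousOp d S) (hT : IsHomogeneousOp d T) : IsHomogeneousOp d (S - T) :=
  fun n f hf => (hS n f hf).sub (hT n f hf)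

lemma smul (r : ℂ) (hT : IsHomogeneousOp d T) : IsHomogeneousOp d (r • T) :=
  fun n f hf => (weightedHomogeneousSubmodule ℂ wtH (n + d)).smul_mem r (hT n f hf)

lemma mul (hS : IsHomogeneousOp d S) (hT : IsHomogeneousOp e T) : IsHomogeneousOp (d + e) (S * T) :=
  fun n f hf => by
    have := hS _ _ (hT n f hf)
    rwa [add_assoc, add_comm e] at this

lemma one : IsHomogeneousOp 0 1 := fun _ _ hf => hf

lemma dop_pow (m : ℕ) : IsHomogeneousOp m (Dop ^ m) := by
  induction m with
  | zero => exact one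
  | succ m ih => exact ih.mul dop

lemma sum {ι : Type*} (s : Finset ι) {T : ι → Module.End ℂ HH}
    (hT : ∀ i ∈ s, IsHomogeneousOp d (T i)) : IsHomogeneousOp d (∑ i ∈ s, T i) := fun n f hf => by
  rw [LinearMap.sum_apply]
  exact IsWeightedHomogeneous.sum _ _ _ fun i hi => hT i hi n f hf

lemma lopH : IsHomogeneousOp 2 LopH :=
  (dop_pow 2).sub (mulH (isWeightedHomogeneous_X ℂ wtH 0))

end IsHomogeneousOp

/-! ### Principal symbols -/

/-- `T` behaves like a differential operator of order at most `n` whose coefficient of `∂ ^ n`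
is `c`. -/
def HasSymbol (n : ℕ) (c : HH) (T : Module.End ℂ HH) : Prop :=
  ∃ M, ∀ N ≥ M, pderiv (N + n) (T (X N)) = c ∧ ∀ j > n, pderiv (N + j) (T (X N)) = 0

namespace HasSymbol

variable {m n : ℕ} {b c : HH} {S T : Module.End ℂ HH}

lemma unique (hb : HasSymbol n b T) (hc : HasSymbol n c T) : b = c := by
  obtain ⟨M, hM⟩ := hb
  obtain ⟨M', hM'⟩ := hc
  rw [← (hM (M + M') (by omega)).1, (hM' (M + M') (by omega)).1]

lemma add (hS : HasSymbol n b S) (hT : HasSymbol n c T) : HasSymbol n (b + c) (S + T) := by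
  obtain ⟨M, hM⟩ := hS
  obtain ⟨M', hM'⟩ := hT
  refine ⟨M + M', fun N hN => ⟨?_, fun j hj => ?_⟩⟩
  · simp [(hM N (by omega)).1, (hM' N (by omega)).1]
  · simp [(hM N (by omega)).2 j hj, (hM' N (by omega)).2 j hj]

lemma smul (r : ℂ) (hT : HasSymbol n c T) : HasSymbol n (r • c) (r • T) := by
  obtain ⟨M, hM⟩ := hT
  refine ⟨M, fun N hN => ⟨?_, fun j hj => ?_⟩⟩
  · simp [(hM N hN).1]
  · simp [(hM N hN).2 j hj]

lemma zero (n : ℕ) : HasSymbol n 0 0 := ⟨0, by simp⟩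

lemma sum {ι : Type*} (s : Finset ι) {c : ι → HH} {T : ι → Module.End ℂ HH}
    (h : ∀ i ∈ s, HasSymbol n (c i) (T i)) : HasSymbol n (∑ i ∈ s, c i) (∑ i ∈ s, T i) := by
  classical
  induction s using Finset.induction_on with
  | empty => simpa using zero n
  | insert a s ha ih =>
    rw [Finset.sum_insert ha, Finset.sum_insert ha]
    exact (h a (by simp)).add (ih fun i hi => h i (by simp [hi]))

lemma of_lt (hT : HasSymbol m c T) (h : m < n) : HasSymbol n 0 T := by
  obtain ⟨M, hM⟩ := hT
  exact ⟨M, fun N hN => ⟨(hM N hN).2 n h, fun j hj => (hM N hN).2 j (by omega)⟩⟩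

lemma one : HasSymbol 0 1 1 := by
  refine ⟨0, fun N _ => ⟨by simp, fun j hj => ?_⟩⟩
  exact pderiv_X_of_ne (by omega)

lemma dop_mul (hT : HasSymbol n c T) : HasSymbol (n + 1) c (Dop * T) := by
  obtain ⟨M, hM⟩ := hT
  refine ⟨M, fun N hN => ⟨?_, fun j hj => ?_⟩⟩
  · rw [← add_assoc, Module.End.mul_apply, Dop_apply, pderiv_succ_Hder, add_assoc,
      (hM N hN).2 _ (by omega), (hM N hN).1, map_zero, zero_add]
  · obtain ⟨j, rfl⟩ : ∃ i, j = i + 1 := ⟨j - 1, by omega⟩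
    rw [← add_assoc, Module.End.mul_apply, Dop_apply, pderiv_succ_Hder, add_assoc,
      (hM N hN).2 _ (by omega), (hM N hN).2 _ (by omega), map_zero, zero_add]

lemma mul_dop (hT : HasSymbol n c T) : HasSymbol (n + 1) c (T * Dop) := by
  obtain ⟨M, hM⟩ := hT
  refine ⟨M, fun N hN => ⟨?_, fun j hj => ?_⟩⟩
  · have := (hM (N + 1) (by omega)).1
    rwa [add_right_comm, add_assoc, ← Hder_X] at this
  · have := (hM (N + 1) (by omega)).2 (j - 1) (by omega)
    rwa [show N + 1 + (j - 1) = N + j by omega, ← Hder_X] at this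

lemma mulH_mul (b : HH) (hT : HasSymbol n c T) : HasSymbol n (b * c) (mulH b * T) := by
  obtain ⟨M, hM⟩ := hT
  obtain ⟨M', hM'⟩ := exists_pderiv_eq_zero b
  refine ⟨M + M', fun N hN => ⟨?_, fun j hj => ?_⟩⟩
  · simp [hM' (N + n) (by omega), (hM N (by omega)).1]
  · simp [hM' (N + j) (by omega), (hM N (by omega)).2 j hj]

lemma dop_pow_mul (m : ℕ) (hT : HasSymbol n c T) : HasSymbol (n + m) c (Dop ^ m * T) := by
  induction m with
  | zero => simpa using hT
  | succ m ih =>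
    rw [pow_succ', mul_assoc]
    exact ih.dop_mul

lemma mul_dop_pow (m : ℕ) (hT : HasSymbol n c T) : HasSymbol (n + m) c (T * Dop ^ m) := by
  induction m with
  | zero => simpa using hT
  | succ m ih =>
    rw [pow_succ, ← mul_assoc]
    exact ih.mul_dop

lemma mulH (c : HH) : HasSymbol 0 c (mulH c) := by
  simpa using one.mulH_mul c

lemma isWeightedHomogeneous {d : ℕ} (hc : HasSymbol n c T) (hT : IsHomogeneousOp d T)
    (hn : n ≤ d) : c.IsWeightedHomogeneous wtH (d - n) := by
  obtain ⟨M, hM⟩ := hc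
  rw [← (hM M le_rfl).1]
  refine IsWeightedHomogeneous.pderiv (hT _ _ (isWeightedHomogeneous_X ℂ wtH M)) ?_
  simp only [wtH]
  omega

end HasSymbol

/-! ### Differential operators together with their formal adjoints -/

/-- `A` is a differential operator of order less than `n` and `B` is its formal adjoint, the
adjoint of `c ∘ ∂ ^ i` being `(-∂) ^ i ∘ c`. -/
inductive IsAdjointPair (n : ℕ) : Module.End ℂ HH → Module.End ℂ HH → Prop
  | monomial {i : ℕ} (hi : i < n) (c : HH) :
      IsAdjointPair n (mulH c * Dop ^ i) ((-1 : ℂ) ^ i • (Dop ^ i * mulH c))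
  | zero : IsAdjointPair n 0 0
  | add {A B A' B' : Module.End ℂ HH} :
      IsAdjointPair n A B → IsAdjointPair n A' B' → IsAdjointPair n (A + A') (B + B')
  | smul {A B : Module.End ℂ HH} (r : ℂ) :
      IsAdjointPair n A B → IsAdjointPair n (r • A) (r • B)

namespace IsAdjointPair

variable {m n : ℕ} {A B : Module.End ℂ HH}

lemma mono (h : IsAdjointPair m A B) (hmn : m ≤ n) : IsAdjointPair n A B := by
  induction h with
  | monomial hi c => exact monomial (hi.trans_le hmn) c
  | zero => exact zero
  | add _ _ h h' => exact h.add h'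
  | smul r _ h => exact h.smul r

lemma eq_zero (h : IsAdjointPair 0 A B) : A = 0 := by
  induction h with
  | monomial hi _ => exact absurd hi (Nat.not_lt_zero _)
  | zero => rfl
  | add _ _ h h' => rw [h, h', add_zero]
  | smul r _ h => rw [h, smul_zero]

lemma dop_mul (h : IsAdjointPair n A B) :
    IsAdjointPair (n + 1) (Dop * A) ((-1 : ℂ) • (B * Dop)) := by
  induction h with
  | @monomial i hi c =>
    have h1 := (monomial (n := n + 1) (hi.trans n.lt_succ_self) (Hder c)).add
      (monomial (Nat.succ_lt_succ hi) c)
    convert h1 using 1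
    · rw [← mul_assoc, Dop_mul_mulH, add_mul, pow_succ', mul_assoc (mulH c)]
    · have hs : (-1 : ℂ) ^ i + -1 * (-1) ^ i = 0 := by ring
      rw [smul_mul_assoc, mul_assoc, smul_smul, pow_succ Dop, mul_assoc, Dop_mul_mulH, mul_add,
        smul_add, pow_succ' (-1 : ℂ), ← add_assoc, ← add_smul, hs, zero_smul, zero_add]
  | zero => simpa using zero
  | add _ _ h h' => simpa only [mul_add, add_mul, smul_add] using h.add h'
  | smul r _ h =>
    simpa only [mul_smul_comm, smul_mul_assoc, smul_comm (-1 : ℂ) r] using h.smul r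

lemma mulH_mul (b : HH) (h : IsAdjointPair n A B) :
    IsAdjointPair n (mulH b * A) (B * mulH b) := by
  induction h with
  | monomial hi c =>
    convert monomial hi (b * c) using 1
    · rw [_root_.mulH_mul, mul_assoc]
    · rw [mul_comm b, _root_.mulH_mul, smul_mul_assoc, mul_assoc]
  | zero => simpa using zero
  | add _ _ h h' => simpa only [mul_add, add_mul] using h.add h'
  | smul r _ h => simpa only [mul_smul_comm, smul_mul_assoc] using h.smul r

lemma dop_pow_mul_mulH (c : HH) (i : ℕ) :
    IsAdjointPair (i + 1) (Dop ^ i * mulH c) ((-1 : ℂ) ^ i • (mulH c * Dop ^ i)) := by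
  induction i with
  | zero => simpa using monomial zero_lt_one c
  | succ i ih =>
    have := ih.dop_mul
    rwa [← mul_assoc, ← pow_succ', smul_mul_assoc, mul_assoc (mulH c), ← pow_succ, smul_smul,
      ← pow_succ'] at this

lemma symm (h : IsAdjointPair n A B) : IsAdjointPair n B A := by
  induction h with
  | @monomial i hi c =>
    have := ((dop_pow_mul_mulH c i).mono hi).smul ((-1 : ℂ) ^ i)
    rwa [smul_smul, ← mul_pow, neg_one_mul, neg_neg, one_pow, one_smul] at this
  | zero => exact zero
  | add _ _ h h' => exact h.add h'
  | smul r _ h => exact h.smul r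

lemma lopH_mul (h : IsAdjointPair n A B) : IsAdjointPair (n + 2) (LopH * A) (B * LopH) := by
  have := h.dop_mul.dop_mul.add ((h.mulH_mul (-X 0)).mono (by omega))
  rwa [smul_mul_assoc, smul_smul, neg_one_mul, neg_neg, one_smul, ← mul_assoc, mul_assoc B,
    ← add_mul, ← mul_add, ← sq, ← lopH_eq] at this

lemma mul_lopH (h : IsAdjointPair n A B) : IsAdjointPair (n + 2) (A * LopH) (LopH * B) :=
  h.symm.lopH_mul.symm

lemma exists_eq_add (h : IsAdjointPair (n + 1) A B) : ∃ c A' B', IsAdjointPair n A' B' ∧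
    A = A' + mulH c * Dop ^ n ∧ B = B' + (-1 : ℂ) ^ n • (Dop ^ n * mulH c) := by
  induction h with
  | @monomial i hi c =>
    rcases Nat.lt_succ_iff_lt_or_eq.mp hi with hi | rfl
    · exact ⟨0, _, _, monomial hi c, by simp⟩
    · exact ⟨c, 0, 0, zero, by simp⟩
  | zero => exact ⟨0, 0, 0, zero, by simp⟩
  | add _ _ h h' =>
    obtain ⟨a, A, B, h, rfl, rfl⟩ := h
    obtain ⟨a', A', B', h', rfl, rfl⟩ := h'
    refine ⟨a + a', _, _, h.add h', ?_, ?_⟩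
    · rw [mulH_add, add_mul]
      abel
    · rw [mulH_add, mul_add, smul_add]
      abel
  | smul r _ h =>
    obtain ⟨a, A, B, h, rfl, rfl⟩ := h
    refine ⟨r • a, _, _, h.smul r, ?_, ?_⟩
    · rw [mulH_smul, smul_add, smul_mul_assoc]
    · rw [mulH_smul, smul_add, mul_smul_comm, smul_comm r]

lemma hasSymbol_zero (h : IsAdjointPair n A B) : HasSymbol n 0 A := by
  induction h with
  | monomial hi c => exact ((HasSymbol.mulH c).mul_dop_pow _).of_lt (by omega)
  | zero => exact HasSymbol.zero n
  | add _ _ h h' => simpa only [add_zero] using h.add h'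
  | smul r _ h => simpa only [smul_zero] using h.smul r

lemma exists_hasSymbol (h : IsAdjointPair (n + 1) A B) :
    ∃ c, HasSymbol n c A ∧ HasSymbol n ((-1 : ℂ) ^ n • c) B := by
  obtain ⟨c, A', B', h', hA', hB'⟩ := h.exists_eq_add
  have h1 := (HasSymbol.mulH c).mul_dop_pow n
  have h2 := ((HasSymbol.mulH c).dop_pow_mul n).smul ((-1 : ℂ) ^ n)
  rw [zero_add] at h1 h2
  refine ⟨c, ?_, ?_⟩
  · simpa only [hA', zero_add] using h'.hasSymbol_zero.add h1
  · simpa only [hB', zero_add] using h'.symm.hasSymbol_zero.add h2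

/-- The order drops below `n` when the symbol of order `n` vanishes. -/
lemma of_hasSymbol_zero (h : IsAdjointPair (n + 1) A B) (hA : HasSymbol n 0 A) :
    IsAdjointPair n A B := by
  obtain ⟨c, A', B', h', hA', hB'⟩ := h.exists_eq_add
  have h1 := (HasSymbol.mulH c).mul_dop_pow n
  rw [zero_add] at h1
  have hc : c = 0 := by
    rw [hA'] at hA
    simpa only [zero_add] using (h'.hasSymbol_zero.add h1).unique hA
  rw [hA', hB', hc, mulH_zero, zero_mul, mul_zero, smul_zero, add_zero, add_zero]
  exact h'

/-- A skew-adjoint operator has odd order. -/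
lemma of_even {l : ℕ} (h : IsAdjointPair (2 * l + 1) A ((-1 : ℂ) • A)) :
    IsAdjointPair (2 * l) A ((-1 : ℂ) • A) := by
  obtain ⟨c, hc, hc'⟩ := h.exists_hasSymbol
  refine h.of_hasSymbol_zero ?_
  rw [pow_mul, neg_one_sq, one_pow, one_smul] at hc'
  have := hc'.unique (hc.smul (-1))
  rw [neg_one_smul] at this
  exact self_eq_neg.mp this ▸ hc

end IsAdjointPair

/-! ### Skew-adjoint operators -/

/-- The operator `c ∘ ∂ ^ m + ∂ ^ m ∘ c`. -/
def symOp (c : HH) (m : ℕ) : Module.End ℂ HH := mulH c * Dop ^ m + Dop ^ m * mulH c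

lemma symOp_add (a b : HH) (m : ℕ) : symOp (a + b) m = symOp a m + symOp b m := by
  simp only [symOp, mulH_add, add_mul, mul_add]
  abel

@[simp] lemma symOp_zero (m : ℕ) : symOp 0 m = 0 := by simp [symOp]

lemma HasSymbol.symOp (c : HH) (m : ℕ) : HasSymbol m (c + c) (symOp c m) := by
  have h1 := (HasSymbol.mulH c).mul_dop_pow m
  have h2 := (HasSymbol.mulH c).dop_pow_mul m
  rw [zero_add] at h1 h2
  exact h1.add h2

lemma IsHomogeneousOp.symOp {c : HH} {d m e : ℕ} (hc : c.IsWeightedHomogeneous wtH d)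
    (h : d + m = e) : IsHomogeneousOp e (symOp c m) := by
  subst h
  exact ((IsHomogeneousOp.mulH hc).mul (dop_pow m)).add
    (add_comm m d ▸ (dop_pow m).mul (IsHomogeneousOp.mulH hc))

lemma IsAdjointPair.symOp (c : HH) {m : ℕ} (hm : Odd m) :
    IsAdjointPair (m + 1) (symOp c m) ((-1 : ℂ) • symOp c m) := by
  have h := monomial m.lt_succ_self c
  rw [hm.neg_one_pow] at h
  have h' := h.add (h.symm.smul (-1))
  rwa [smul_smul, neg_one_mul, neg_neg, one_smul, ← smul_add, add_comm (Dop ^ m * _)] at h'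

/-- A homogeneous skew-adjoint operator is a sum of operators `c ∘ ∂ ^ m + ∂ ^ m ∘ c`, `m` odd. -/
lemma exists_eq_sum_symOp {d : ℕ} (l : ℕ) (hl : 2 * l ≤ d + 1) {A : Module.End ℂ HH}
    (hA : IsAdjointPair (2 * l) A ((-1 : ℂ) • A)) (hd : IsHomogeneousOp d A) :
    ∃ α : ℕ → HH, (∀ i < l, (α i).IsWeightedHomogeneous wtH (d - (2 * i + 1))) ∧
      A = ∑ i ∈ Finset.range l, symOp (α i) (2 * i + 1) := by
  induction l generalizing A with
  | zero =>
    refine ⟨0, by simp, ?_⟩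
    rw [Finset.sum_range_zero]
    exact IsAdjointPair.eq_zero hA
  | succ l ih =>
    obtain ⟨c, hc, -⟩ := hA.exists_hasSymbol (n := 2 * l + 1)
    have hcw := hc.isWeightedHomogeneous hd (by omega)
    set b : HH := (-1 / 2 : ℂ) • c with hb
    have hbw : b.IsWeightedHomogeneous wtH (d - (2 * l + 1)) :=
      (weightedHomogeneousSubmodule ℂ wtH _).smul_mem _ hcw
    have hbc : c + (b + b) = 0 := by
      rw [hb, ← add_smul]
      nth_rewrite 1 [← one_smul ℂ c]
      rw [← add_smul]
      norm_num
    have hmem := hA.add (IsAdjointPair.symOp b (m := 2 * l + 1) ⟨l, rfl⟩)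
    rw [← smul_add] at hmem
    have hmem1 := hmem.of_hasSymbol_zero (n := 2 * l + 1)
      (hbc ▸ hc.add (HasSymbol.symOp b (2 * l + 1)))
    obtain ⟨α, hα, hsum⟩ := ih (by omega) hmem1.of_even
      (hd.add (IsHomogeneousOp.symOp hbw (by omega)))
    refine ⟨Function.update α l (-b), fun i hi => ?_, ?_⟩
    · rcases Nat.lt_succ_iff_lt_or_eq.mp hi with hi | rfl
      · simpa [hi.ne] using hα i hi
      · simpa using hbw.neg
    · have hα' : ∑ i ∈ Finset.range l, symOp (Function.update α l (-b) i) (2 * i + 1) =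
          ∑ i ∈ Finset.range l, symOp (α i) (2 * i + 1) :=
        Finset.sum_congr rfl fun i hi => by
          rw [Function.update_of_ne (Finset.mem_range.mp hi).ne]
      rw [Finset.sum_range_succ, Function.update_self, hα', ← hsum, add_assoc, ← symOp_add,
        add_neg_cancel, symOp_zero, add_zero]

/-! ### The Lenard sequence -/

/-- The coefficients of the normalized solution `R = ∑ Rₙ zⁿ` of
`4 R² = z (2 R R'' - R'² - 4 u₀ R²) + 4`. -/
def lenard : ℕ → HH
  | 0 => 1
  | n + 1 => C (1 / 8) *
      (∑ i : Fin (n + 1), (2 * (lenard i * Hder (Hder (lenard (n - i)))) -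
        Hder (lenard i) * Hder (lenard (n - i)) - 4 * (X 0 * (lenard i * lenard (n - i)))) -
      4 * ∑ i : Fin n, lenard (i + 1) * lenard (n - i))

@[simp] lemma lenard_zero : lenard 0 = 1 := by rw [lenard]

lemma lenard_isWeightedHomogeneous (n : ℕ) : (lenard n).IsWeightedHomogeneous wtH (2 * n) := by
  induction n using Nat.strong_induction_on with
  | _ n ih =>
    cases n with
    | zero => simpa using isWeightedHomogeneous_one ℂ wtH
    | succ n =>
      have two_mul_wt {f : HH} {d : ℕ} (hf : f.IsWeightedHomogeneous wtH d) :
          (2 * f).IsWeightedHomogeneous wtH d := by simpa [two_mul] using hf.add hf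
      have four_mul_wt {f : HH} {d : ℕ} (hf : f.IsWeightedHomogeneous wtH d) :
          (4 * f).IsWeightedHomogeneous wtH d := by
        convert two_mul_wt (two_mul_wt hf) using 1
        ring
      rw [lenard]
      refine IsWeightedHomogeneous.C_mul (IsWeightedHomogeneous.sub
        (IsWeightedHomogeneous.sum _ _ _ fun i _ => ?_)
        (four_mul_wt (IsWeightedHomogeneous.sum _ _ _ fun i _ => ?_))) _
      · have h1 := ih i (by omega)
        have h2 := ih (n - i) (by omega)
        refine ((two_mul_wt ?_).sub ?_).sub (four_mul_wt ?_)
        · convert h1.mul (IsWeightedHomogeneous.Hder (IsWeightedHomogeneous.Hder h2)) using 1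
          omega
        · have h := (IsWeightedHomogeneous.Hder h1).mul (IsWeightedHomogeneous.Hder h2)
          rwa [show 2 * (i : ℕ) + 1 + (2 * (n - i) + 1) = 2 * (n + 1) by omega] at h
        · convert (isWeightedHomogeneous_X ℂ wtH 0).mul (h1.mul h2) using 1
          simp only [wtH]
          omega
      · convert (ih (i + 1) (by omega)).mul (ih (n - i) (by omega)) using 1
        omega

open Finset.HasAntidiagonal (antidiagonal mem_antidiagonal)

lemma sum_antidiagonal_lenard (n : ℕ) :
    4 * ∑ p ∈ antidiagonal (n + 1), lenard p.1 * lenard p.2 =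
      ∑ p ∈ antidiagonal n, (2 * (lenard p.1 * Hder (Hder (lenard p.2))) -
        Hder (lenard p.1) * Hder (lenard p.2) - 4 * (X 0 * (lenard p.1 * lenard p.2))) := by
  have h8 : (8 : HH) * C (1 / 8) = 1 := by
    rw [show (8 : HH) = C 8 from (map_ofNat C 8).symm, ← C_mul]
    norm_num
  have h := congrArg (fun f : HH => 8 * f) (lenard.eq_2 n)
  simp only [← mul_assoc 8 (C _), h8, one_mul] at h
  rw [Finset.sum_range (fun i => lenard (i + 1) * lenard (n - i)) |>.symm,
    Finset.sum_range (fun i => 2 * (lenard i * Hder (Hder (lenard (n - i)))) -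
        Hder (lenard i) * Hder (lenard (n - i)) - 4 * (X 0 * (lenard i * lenard (n - i)))) |>.symm,
    eq_sub_iff_add_eq] at h
  rw [Finset.Nat.sum_antidiagonal_eq_sum_range_succ_mk,
    Finset.Nat.sum_antidiagonal_eq_sum_range_succ_mk, ← h, Finset.sum_range_succ,
    Finset.sum_range_succ', Nat.sub_self, Nat.sub_zero, lenard_zero]
  simp only [Nat.add_sub_add_right]
  ring

/-- The Lenard recursion. -/
lemma four_mul_Hder_lenard_succ (n : ℕ) : 4 * Hder (lenard (n + 1)) =
    Hder (Hder (Hder (lenard n))) - 4 * (X 0 * Hder (lenard n)) - 2 * (X 1 * lenard n) := by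
  set E : ℕ → HH := fun n => 4 * Hder (lenard (n + 1)) - Hder (Hder (Hder (lenard n))) +
    4 * (X 0 * Hder (lenard n)) + 2 * (X 1 * lenard n) with hE
  suffices E n = 0 by linear_combination this
  have h4 (f : HH) : Hder (4 * f) = 4 * Hder f := by
    rw [show (4 : HH) = C 4 from (map_ofNat C 4).symm, ← smul_eq_C_mul, ← smul_eq_C_mul,
      Derivation.map_smul]
  have h2 (f : HH) : Hder (2 * f) = 2 * Hder f := by
    rw [show (2 : HH) = C 2 from (map_ofNat C 2).symm, ← smul_eq_C_mul, ← smul_eq_C_mul,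
      Derivation.map_smul]
  have hsum (n : ℕ) : ∑ p ∈ antidiagonal n, lenard p.1 * E p.2 = 0 := by
    have h := congrArg Hder (sum_antidiagonal_lenard n)
    have hs1 : ∑ p ∈ antidiagonal (n + 1), Hder (lenard p.1) * lenard p.2 =
        ∑ p ∈ antidiagonal (n + 1), lenard p.1 * Hder (lenard p.2) := by
      rw [← Finset.Nat.sum_antidiagonal_swap]
      exact Finset.sum_congr rfl fun p _ => mul_comm _ _
    have hs2 : ∑ p ∈ antidiagonal n, Hder (lenard p.1) * lenard p.2 =
        ∑ p ∈ antidiagonal n, lenard p.1 * Hder (lenard p.2) := by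
      rw [← Finset.Nat.sum_antidiagonal_swap]
      exact Finset.sum_congr rfl fun p _ => mul_comm _ _
    have hs3 : ∑ p ∈ antidiagonal n, Hder (Hder (lenard p.1)) * Hder (lenard p.2) =
        ∑ p ∈ antidiagonal n, Hder (lenard p.1) * Hder (Hder (lenard p.2)) := by
      rw [← Finset.Nat.sum_antidiagonal_swap]
      exact Finset.sum_congr rfl fun p _ => mul_comm _ _
    have hs4 : ∑ p ∈ antidiagonal (n + 1), lenard p.1 * Hder (lenard p.2) =
        ∑ p ∈ antidiagonal n, lenard p.1 * Hder (lenard (p.2 + 1)) := by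
      rw [Finset.Nat.sum_antidiagonal_succ']
      simp
    have hl : Hder (4 * ∑ p ∈ antidiagonal (n + 1), lenard p.1 * lenard p.2) =
        4 * (∑ p ∈ antidiagonal (n + 1), lenard p.1 * Hder (lenard p.2) +
          ∑ p ∈ antidiagonal (n + 1), Hder (lenard p.1) * lenard p.2) := by
      rw [h4, map_sum, ← Finset.sum_add_distrib]
      refine congrArg (4 * ·) (Finset.sum_congr rfl fun p _ => ?_)
      rw [Derivation.leibniz, smul_eq_mul, smul_eq_mul, mul_comm (lenard p.2)]
    have hr : Hder (∑ p ∈ antidiagonal n, (2 * (lenard p.1 * Hder (Hder (lenard p.2))) -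
          Hder (lenard p.1) * Hder (lenard p.2) - 4 * (X 0 * (lenard p.1 * lenard p.2)))) =
        ∑ p ∈ antidiagonal n, Hder (lenard p.1) * Hder (Hder (lenard p.2)) +
        2 * ∑ p ∈ antidiagonal n, lenard p.1 * Hder (Hder (Hder (lenard p.2))) -
        ∑ p ∈ antidiagonal n, Hder (Hder (lenard p.1)) * Hder (lenard p.2) -
        4 * X 1 * ∑ p ∈ antidiagonal n, lenard p.1 * lenard p.2 -
        4 * X 0 * ∑ p ∈ antidiagonal n, lenard p.1 * Hder (lenard p.2) -
        4 * X 0 * ∑ p ∈ antidiagonal n, Hder (lenard p.1) * lenard p.2 := by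
      simp only [map_sum, Finset.mul_sum, ← Finset.sum_add_distrib, ← Finset.sum_sub_distrib]
      refine Finset.sum_congr rfl fun p _ => ?_
      simp only [map_sub, h4, h2, Derivation.leibniz, smul_eq_mul, Hder_X, zero_add]
      ring
    have hE' : ∑ p ∈ antidiagonal n, lenard p.1 * E p.2 =
        4 * ∑ p ∈ antidiagonal n, lenard p.1 * Hder (lenard (p.2 + 1)) -
        ∑ p ∈ antidiagonal n, lenard p.1 * Hder (Hder (Hder (lenard p.2))) +
        4 * X 0 * ∑ p ∈ antidiagonal n, lenard p.1 * Hder (lenard p.2) +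
        2 * X 1 * ∑ p ∈ antidiagonal n, lenard p.1 * lenard p.2 := by
      simp only [hE, Finset.mul_sum, ← Finset.sum_add_distrib, ← Finset.sum_sub_distrib]
      refine Finset.sum_congr rfl fun p _ => ?_
      ring
    rw [hl, hr, hs1, hs2, hs3, hs4] at h
    rw [hE']
    refine mul_left_cancel₀ (two_ne_zero' HH) ?_
    linear_combination h
  induction n using Nat.strong_induction_on with
  | _ n ih =>
    have h := hsum n
    rwa [Finset.sum_eq_single (0, n), lenard_zero, one_mul] at h
    · rintro ⟨i, j⟩ hij hne
      rw [mem_antidiagonal] at hij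
      have hj : j < n := by
        refine lt_of_le_of_ne (by omega) fun hj => hne ?_
        ext <;> simp <;> omega
      rw [ih j hj, mul_zero]
    · simp

lemma lopH_apply (f : HH) : LopH f = Hder (Hder f) - X 0 * f := by
  simp [LopH, sq]

/-- Skew-adjoint operators of order `2 * k + 1` which commute with `L` up to multiplication
operators. -/
def lenardOp : ℕ → Module.End ℂ HH
  | 0 => Dop
  | k + 1 => (1 / 2 : ℂ) • (lenardOp k * LopH + LopH * lenardOp k + symOp (lenard (k + 1)) 1)

lemma lopH_lenardOp_apply (k : ℕ) (f : HH) :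
    LopH (lenardOp k f) = lenardOp k (LopH f) - 2 * Hder (lenard (k + 1)) * f := by
  induction k generalizing f with
  | zero =>
    have h := four_mul_Hder_lenard_succ 0
    simp only [lenard_zero, Derivation.map_one_eq_zero, map_zero] at h
    simp only [lenardOp, Dop_apply, lopH_apply, map_sub, Derivation.leibniz, smul_eq_mul, Hder_X]
    have h2 : (2 : HH) ≠ 0 := two_ne_zero
    refine mul_left_cancel₀ h2 ?_
    linear_combination f * h
  | succ k ih =>
    have h := four_mul_Hder_lenard_succ (k + 1)
    set R := lenard (k + 1)
    set A := lenardOp k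
    have hA (g : HH) : (2 : ℂ) • lenardOp (k + 1) g =
        A (LopH g) + LopH (A g) + symOp (lenard (k + 1)) 1 g := by
      rw [show lenardOp (k + 1) = (1 / 2 : ℂ) • (A * LopH + LopH * A + symOp R 1) from rfl,
        LinearMap.smul_apply, smul_smul]
      norm_num
      rfl
    have hS (g : HH) : symOp R 1 g = 2 * (R * Hder g) + Hder R * g := by
      rw [symOp, pow_one, LinearMap.add_apply, Module.End.mul_apply, Module.End.mul_apply,
        mulH_apply, mulH_apply, Dop_apply, Dop_apply, Derivation.leibniz, smul_eq_mul, smul_eq_mul]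
      ring
    have hLA (g : HH) : LopH (A g) = A (LopH g) - 2 * Hder R * g := ih g
    have h2 (f : HH) : Hder (2 * f) = 2 * Hder f := by
      rw [two_mul, map_add, two_mul]
    have hL := congrArg LopH (hA f)
    rw [LinearMap.map_smul, LinearMap.map_add, LinearMap.map_add, hLA f, LinearMap.map_sub,
      hLA (LopH f), hS] at hL
    have hR := hA (LopH f)
    rw [hLA, hS] at hR
    have htwo (g : HH) : (2 : ℂ) • g = 2 * g := by rw [two_smul, two_mul]
    rw [htwo] at hL hR
    refine mul_left_cancel₀ (two_ne_zero' HH) ?_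
    rw [hL, mul_sub, hR]
    simp only [lopH_apply, map_add, map_sub, Derivation.leibniz, smul_eq_mul, Hder_X, h2, mul_assoc]
    linear_combination f * h

lemma lenardOp_eq (k : ℕ) : ∃ B, lenardOp k = Dop ^ (2 * k + 1) + B ∧
    IsHomogeneousOp (2 * k + 1) B ∧ IsAdjointPair (2 * k + 1) B ((-1 : ℂ) • B) := by
  induction k with
  | zero =>
    refine ⟨0, by simp [lenardOp], fun n f _ => isWeightedHomogeneous_zero ℂ wtH _, ?_⟩
    rw [smul_zero]
    exact IsAdjointPair.zero
  | succ k ih =>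
    obtain ⟨B, hB, hw, hadj⟩ := ih
    refine ⟨(1 / 2 : ℂ) • (B * LopH + LopH * B + symOp (-X 0) (2 * k + 1) +
      symOp (lenard (k + 1)) 1), ?_, ?_, ?_⟩
    · have h : Dop ^ (2 * k + 1) * LopH + LopH * Dop ^ (2 * k + 1) =
          (2 : ℂ) • Dop ^ (2 * (k + 1) + 1) + symOp (-X 0) (2 * k + 1) := by
        rw [lopH_eq, mul_add, add_mul, ← pow_add, ← pow_add, symOp,
          show 2 * k + 1 + 2 = 2 * (k + 1) + 1 by ring,
          show 2 + (2 * k + 1) = 2 * (k + 1) + 1 by ring, two_smul]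
        abel
      have h' : (Dop ^ (2 * k + 1) + B) * LopH + LopH * (Dop ^ (2 * k + 1) + B) =
          (2 : ℂ) • Dop ^ (2 * (k + 1) + 1) +
            (B * LopH + LopH * B + symOp (-X 0) (2 * k + 1)) := by
        rw [add_mul, mul_add, add_add_add_comm, h]
        abel
      rw [lenardOp, hB, h', add_assoc, smul_add, smul_smul]
      norm_num
    · refine IsHomogeneousOp.smul _ (((IsHomogeneousOp.add ?_ ?_).add ?_).add ?_)
      · exact hw.mul IsHomogeneousOp.lopH
      · convert IsHomogeneousOp.lopH.mul hw using 1
        ring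
      · refine IsHomogeneousOp.symOp (isWeightedHomogeneous_X ℂ wtH 0).neg ?_
        simp only [wtH]
        ring
      · exact IsHomogeneousOp.symOp (lenard_isWeightedHomogeneous (k + 1)) rfl
    · have h1 := hadj.mul_lopH.add hadj.lopH_mul
      have h2 := (IsAdjointPair.symOp (-X 0) (m := 2 * k + 1) ⟨k, rfl⟩).mono
        (show 2 * k + 1 + 1 ≤ 2 * k + 1 + 2 by omega)
      have h3 := (IsAdjointPair.symOp (lenard (k + 1)) odd_one).mono
        (show 1 + 1 ≤ 2 * k + 1 + 2 by omega)
      have h := ((h1.add h2).add h3).smul (1 / 2)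
      have he : LopH * ((-1 : ℂ) • B) + ((-1 : ℂ) • B) * LopH =
          (-1 : ℂ) • (B * LopH + LopH * B) := by
        rw [mul_smul_comm, smul_mul_assoc, smul_add, add_comm]
      rw [he, ← smul_add, ← smul_add, smul_comm (1 / 2 : ℂ) (-1 : ℂ)] at h
      exact h

/-! ### Uniqueness -/

lemma hasSymbol_lie_lopH_symOp (c : HH) (m : ℕ) :
    HasSymbol (m + 1) (4 * Hder c) ⁅LopH, symOp c m⁆ := by
  have h : ⁅LopH, symOp c m⁆ = mulH (2 * Hder c) * Dop ^ (m + 1) +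
      Dop ^ m * (mulH (2 * Hder c) * Dop) +
      (mulH (Hder (Hder c)) * Dop ^ m + Dop ^ m * mulH (Hder (Hder c)) +
      mulH c * (Dop ^ m * mulH (X 0)) + Dop ^ m * mulH (c * X 0) +
      mulH (-X 0) * symOp c m) := by
    refine LinearMap.ext fun f => ?_
    have hcomm (g : HH) : Hder ((Dop ^ m) g) = (Dop ^ m) (Hder g) := by
      have := LinearMap.congr_fun (Commute.self_pow Dop m).eq g
      exact this
    have key : (Dop ^ m) (Hder (Hder (c * f))) = (Dop ^ m) (c * Hder (Hder f)) +
        (Dop ^ m) (2 * Hder c * Hder f) + (Dop ^ m) (Hder (Hder c) * f) := by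
      rw [← map_add, ← map_add]
      congr 1
      simp only [map_add, Derivation.leibniz, smul_eq_mul]
      ring
    have hL : LopH (symOp c m f) = c * (Dop ^ m) (Hder (Hder f)) +
        2 * Hder c * (Dop ^ m) (Hder f) + Hder (Hder c) * (Dop ^ m) f +
        (Dop ^ m) (Hder (Hder (c * f))) - X 0 * symOp c m f := by
      rw [lopH_apply, symOp]
      simp only [LinearMap.add_apply, Module.End.mul_apply, mulH_apply, map_add,
        Derivation.leibniz, smul_eq_mul, hcomm]
      ring
    have hR : symOp c m (LopH f) = c * (Dop ^ m) (Hder (Hder f)) -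
        c * (Dop ^ m) (X 0 * f) + (Dop ^ m) (c * Hder (Hder f)) - (Dop ^ m) (c * X 0 * f) := by
      rw [lopH_apply, symOp]
      simp only [LinearMap.add_apply, Module.End.mul_apply, mulH_apply, map_sub,
        mul_assoc]
      ring
    rw [Ring.lie_def, LinearMap.sub_apply, Module.End.mul_apply, Module.End.mul_apply, hL, hR, key]
    simp only [LinearMap.add_apply, Module.End.mul_apply, mulH_apply,
      Dop_apply, pow_succ]
    ring
  have h1 := (HasSymbol.mulH (2 * Hder c)).mul_dop_pow (m + 1)
  have h2 := (HasSymbol.mulH (2 * Hder c)).mul_dop.dop_pow_mul m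
  have h3 := (HasSymbol.mulH (Hder (Hder c))).mul_dop_pow m
  have h4 := (HasSymbol.mulH (Hder (Hder c))).dop_pow_mul m
  have h5 := ((HasSymbol.mulH (X 0)).dop_pow_mul m).mulH_mul c
  have h6 := (HasSymbol.mulH (c * X 0)).dop_pow_mul m
  have h7 := (HasSymbol.symOp c m).mulH_mul (-X 0)
  rw [zero_add] at h1 h3 h4 h5 h6
  rw [zero_add, add_comm 1 m] at h2
  rw [h]
  have h8 := ((((h3.add h4).add h5).add h6).add h7).of_lt m.lt_succ_self
  convert (h1.add h2).add h8 using 1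
  ring

lemma lie_lopH_apply (A : Module.End ℂ HH) (f : HH) : ⁅LopH, A⁆ f = LopH (A f) - A (LopH f) := rfl

lemma lie_lopH_add (A B : Module.End ℂ HH) : ⁅LopH, A + B⁆ = ⁅LopH, A⁆ + ⁅LopH, B⁆ := by
  refine LinearMap.ext fun f => ?_
  rw [LinearMap.add_apply, lie_lopH_apply, lie_lopH_apply, lie_lopH_apply, LinearMap.add_apply,
    LinearMap.add_apply, LinearMap.map_add]
  ring

lemma lie_lopH_zero : ⁅LopH, (0 : Module.End ℂ HH)⁆ = 0 := by
  refine LinearMap.ext fun f => ?_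
  rw [lie_lopH_apply, LinearMap.zero_apply, LinearMap.zero_apply, LinearMap.map_zero, sub_zero]

lemma lie_lopH_sum {ι : Type*} (s : Finset ι) (T : ι → Module.End ℂ HH) :
    ⁅LopH, ∑ i ∈ s, T i⁆ = ∑ i ∈ s, ⁅LopH, T i⁆ := by
  classical
  induction s using Finset.induction_on with
  | empty => exact lie_lopH_zero
  | insert a s ha ih =>
    rw [Finset.sum_insert ha, Finset.sum_insert ha, lie_lopH_add, ih]

lemma aopH_eq (k : ℕ) (α : Fin k → HH) : AopH k α = Dop ^ (2 * k + 1) +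
    ∑ j : Fin k, symOp (α j) (2 * k - 2 * ((j : ℕ) + 1) + 1) := rfl

lemma eq_of_lie_lopH_aopH_eq_mulH {k : ℕ} {α β : Fin k → HH} {r s : HH}
    (hα : ∀ j : Fin k, (α j).IsWeightedHomogeneous wtH (2 * ((j : ℕ) + 1)))
    (hβ : ∀ j : Fin k, (β j).IsWeightedHomogeneous wtH (2 * ((j : ℕ) + 1)))
    (hr : ⁅LopH, AopH k α⁆ = mulH r) (hs : ⁅LopH, AopH k β⁆ = mulH s) : α = β := by
  have hadd : AopH k α = AopH k β +
      ∑ j : Fin k, symOp (α j - β j) (2 * k - 2 * ((j : ℕ) + 1) + 1) := by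
    rw [aopH_eq, aopH_eq, add_assoc, ← Finset.sum_add_distrib]
    simp only [← symOp_add, add_sub_cancel]
  have hlie : mulH r = mulH s +
      ∑ j : Fin k, ⁅LopH, symOp (α j - β j) (2 * k - 2 * ((j : ℕ) + 1) + 1)⁆ := by
    rw [← hr, ← hs, hadd, lie_lopH_add, lie_lopH_sum]
  funext j
  induction j using WellFoundedLT.induction with
  | _ j ih =>
    have hsum := HasSymbol.sum (n := 2 * k - 2 * ((j : ℕ) + 1) + 1 + 1) Finset.univ
      (c := fun i => if i = j then 4 * Hder (α j - β j) else 0)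
      (T := fun i : Fin k => ⁅LopH, symOp (α i - β i) (2 * k - 2 * ((i : ℕ) + 1) + 1)⁆)
      fun i _ => by
        rcases lt_trichotomy i j with hij | hij | hij
        · rw [ih i hij, sub_self, symOp_zero, lie_lopH_zero, if_neg hij.ne]
          exact HasSymbol.zero _
        · rw [hij, if_pos rfl]
          exact hasSymbol_lie_lopH_symOp (α j - β j) _
        · rw [if_neg hij.ne']
          exact (hasSymbol_lie_lopH_symOp (α i - β i) _).of_lt (by omega)
    have h := ((HasSymbol.mulH s).of_lt (Nat.succ_pos _)).add hsum
    rw [← hlie, Finset.sum_ite_eq' Finset.univ j, if_pos (Finset.mem_univ _), zero_add] at h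
    have h0 := h.unique ((HasSymbol.mulH r).of_lt (Nat.succ_pos _))
    have h4 : (4 : HH) ≠ 0 := by
      rw [show (4 : HH) = 2 * 2 by norm_num]
      exact mul_ne_zero two_ne_zero two_ne_zero
    exact sub_eq_zero.mp (eq_zero_of_Hder_eq_zero (by omega) ((hα j).sub (hβ j))
      ((mul_eq_zero.mp h0).resolve_left h4))

lemma isHomogeneousOp_aopH {k : ℕ} {α : Fin k → HH}
    (hα : ∀ j : Fin k, (α j).IsWeightedHomogeneous wtH (2 * ((j : ℕ) + 1))) :
    IsHomogeneousOp (2 * k + 1) (AopH k α) := by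
  rw [aopH_eq]
  exact (IsHomogeneousOp.dop_pow _).add
    (IsHomogeneousOp.sum _ fun j _ => IsHomogeneousOp.symOp (hα j) (by omega))

lemma exists_lenardOp_eq_aopH (k : ℕ) : ∃ α : Fin k → HH,
    (∀ j : Fin k, (α j).IsWeightedHomogeneous wtH (2 * ((j : ℕ) + 1))) ∧
      lenardOp k = AopH k α := by
  obtain ⟨B, hB, hw, hadj⟩ := lenardOp_eq k
  obtain ⟨α, hα, hsum⟩ := exists_eq_sum_symOp k (by omega) hadj.of_even hw
  refine ⟨fun j => α (k - 1 - j), fun j => ?_, ?_⟩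
  · convert hα (k - 1 - j) (by omega) using 1
    omega
  · rw [hB, hsum, aopH_eq, ← Finset.sum_range_reflect, Finset.sum_range]
    refine congrArg (Dop ^ (2 * k + 1) + ·) (Finset.sum_congr rfl fun j _ => ?_)
    have hj : 2 * (k - 1 - (j : ℕ)) + 1 = 2 * k - 2 * ((j : ℕ) + 1) + 1 := by omega
    rw [hj]

theorem stmt0 (k : ℕ) (hk : 1 ≤ k) :
    (∃! α : Fin k → HH,
      (∀ j : Fin k, (α j).IsWeightedHomogeneous wtH (2 * ((j : ℕ) + 1))) ∧
      ∃ r : HH, ⁅LopH, AopH k α⁆ = mulH r) ∧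
    (∀ (α : Fin k → HH) (r : HH),
      (∀ j : Fin k, (α j).IsWeightedHomogeneous wtH (2 * ((j : ℕ) + 1))) →
      ⁅LopH, AopH k α⁆ = mulH r → r.IsWeightedHomogeneous wtH (2 * k + 3)) := by
  refine ⟨?_, fun α r hα hr => ?_⟩
  · obtain ⟨α, hα, hA⟩ := exists_lenardOp_eq_aopH k
    have hr : ⁅LopH, AopH k α⁆ = mulH (-(2 * Hder (lenard (k + 1)))) := by
      refine LinearMap.ext fun f => ?_
      rw [Ring.lie_def, LinearMap.sub_apply, Module.End.mul_apply, Module.End.mul_apply, ← hA,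
        lopH_lenardOp_apply, mulH_apply]
      ring
    exact ⟨α, ⟨hα, _, hr⟩, fun β ⟨hβ, s, hs⟩ => eq_of_lie_lopH_aopH_eq_mulH hβ hα hs hr⟩
  · have hA := isHomogeneousOp_aopH hα
    have h1 := IsHomogeneousOp.lopH.mul hA
    rw [add_comm] at h1
    have h := h1.sub (hA.mul IsHomogeneousOp.lopH) 0 1 (isWeightedHomogeneous_one ℂ wtH)
    rw [← Ring.lie_def, hr, mulH_apply, mul_one, zero_add] at h
    exact h

end
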